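/- Let a < 0 and let (H, φ) solve the EdGB FLRW system on (a, 0] with H(0) = β > 0 and φ'(0) < 0. If H'(0) − (12/5)·β^4·exp(φ(0)) + 3β^2 > 0 and H'(0) − 3·β^4·exp(φ(0)) + β^2 < 0, then H'(t) − (12/5)·H(t)^4·exp(φ(t)) + 3·H(t)^2 > 0 for all t ∈ (a, 0]. -/

import Mathlib

/-- The EdGB FLRW system on a set `I ⊆ ℝ`: `H` is continuously differentiable and
`φ` twice continuously differentiable on `I`, and for every `t ∈ I` the Hamiltonian
constraint `3H² − 3e^φ φ' H³ = φ'²/2` and the scalar field equation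
`φ'' = −3Hφ' − 3e^φ H²(H² + H')` hold. -/
def EdGB (H φ : ℝ → ℝ) (I : Set ℝ) : Prop :=
  ContDiffOn ℝ 1 H I ∧ ContDiffOn ℝ 2 φ I ∧
  (∀ t ∈ I, 3 * H t ^ 2 - 3 * Real.exp (φ t) * deriv φ t * H t ^ 3 = (deriv φ t) ^ 2 / 2) ∧
  (∀ t ∈ I, deriv (deriv φ) t =
      -3 * H t * deriv φ t - 3 * Real.exp (φ t) * H t ^ 2 * (H t ^ 2 + deriv H t))

/-- The differentiated Hamiltonian constraint in the dimensionless variables `u = φ'/H`,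
`x = H²e^φ`, `s = H'/H²` forces `D₃ < 0 < D₄`. -/
theorem dimensionless_bounds {u x s : ℝ} (hu : u < 0) (hx : 0 < x)
    (hc : 6 - 6 * x * u = u ^ 2)
    (hd : 6 * s - 3 * x * u ^ 2 + (3 * x + u) * (3 * u + 3 * x * (1 + s)) - 9 * x * u * s = 0) :
    s - 3 * x + 1 < 0 ∧ 0 < s - 12 / 5 * x + 3 := by
  have hpos : 0 < u ^ 2 + 9 * x ^ 2 := by positivity
  have hs : s * (u ^ 2 + 9 * x ^ 2) = 3 * x * u ^ 2 - 3 * u ^ 2 - 12 * x * u - 9 * x ^ 2 := by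
    linear_combination hd - s * hc
  constructor
  · have h3 : (s - 3 * x + 1) * (u ^ 2 + 9 * x ^ 2) = -(12 + 27 * x ^ 3) := by
      linear_combination hs + 2 * hc
    refine neg_of_mul_neg_left (b := u ^ 2 + 9 * x ^ 2) ?_ hpos.le
    rw [h3]
    exact neg_neg_of_pos (by positivity)
  · have h4 : (s - 12 / 5 * x + 3) * (u ^ 2 + 9 * x ^ 2)
        = x * (3 / 5 * (u ^ 2 - 36 * x ^ 2) - 12 * u + 18 * x) := by
      linear_combination hs
    have hxu : 6 * x < -u := by nlinarith
    have hsq : 0 < u ^ 2 - 36 * x ^ 2 := by nlinarith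
    refine pos_of_mul_pos_left (b := u ^ 2 + 9 * x ^ 2) ?_ hpos.le
    rw [h4]
    apply mul_pos hx
    linarith

/-- The pointwise bounds `H' < 3H⁴e^φ` and `D₄ > 0`, where `h, k` stand for `H, H'`,
`p, q` for `φ', φ''` and `e` for `e^φ`. -/
theorem pointwise_bounds {h p e k q : ℝ} (hh : 0 < h) (hp : p < 0) (he : 0 < e)
    (hc : 3 * h ^ 2 - 3 * e * p * h ^ 3 = p ^ 2 / 2)
    (hq : q = -3 * h * p - 3 * e * h ^ 2 * (h ^ 2 + k))
    (hd : 6 * h * k - 3 * e * p ^ 2 * h ^ 3 - 3 * e * q * h ^ 3 - 9 * e * p * h ^ 2 * k = p * q) :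
    k < 3 * e * h ^ 4 ∧ k - (12 / 5) * h ^ 4 * e + 3 * h ^ 2 > 0 := by
  obtain ⟨u, rfl⟩ : ∃ u, p = u * h := ⟨p / h, by field_simp⟩
  obtain ⟨s, rfl⟩ : ∃ s, k = s * h ^ 2 := ⟨k / h ^ 2, by field_simp⟩
  have hu : u < 0 := neg_of_mul_neg_left hp hh.le
  subst hq
  obtain ⟨h3, h4⟩ := dimensionless_bounds (u := u) (x := e * h ^ 2) (s := s) hu (by positivity)
    (mul_left_cancel₀ (pow_ne_zero 2 hh.ne') (by linear_combination 2 * hc))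
    (mul_left_cancel₀ (pow_ne_zero 3 hh.ne') (by linear_combination hd))
  have hh2 : 0 < h ^ 2 := by positivity
  constructor <;> nlinarith [mul_pos hh2 h4, mul_neg_of_pos_of_neg hh2 h3]

theorem EdGB.bounds_of_mem_Ioo {a b t : ℝ} {H φ : ℝ → ℝ} (hsys : EdGB H φ (Set.Ioc a b))
    (ht : t ∈ Set.Ioo a b) (hH : 0 < H t) (hφ : deriv φ t < 0) :
    deriv H t < 3 * Real.exp (φ t) * H t ^ 4 ∧
      deriv H t - (12 / 5) * H t ^ 4 * Real.exp (φ t) + 3 * H t ^ 2 > 0 := by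
  obtain ⟨hC1, hC2, hcon, hfield⟩ := hsys
  have hnhds : Set.Ioo a b ∈ nhds t := isOpen_Ioo.mem_nhds ht
  have hdH : HasDerivAt H (deriv H t) t :=
    (((hC1.mono Set.Ioo_subset_Ioc_self).contDiffAt hnhds).differentiableAt
      one_ne_zero).hasDerivAt
  have hCφ := hC2.mono (Set.Ioo_subset_Ioc_self (a := b) (b := a))
  have hdφ : HasDerivAt φ (deriv φ t) t :=
    ((hCφ.contDiffAt hnhds).differentiableAt two_ne_zero).hasDerivAt
  have hddφ : HasDerivAt (deriv φ) (deriv (deriv φ) t) t :=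
    (((hCφ.deriv_of_isOpen (m := 1) isOpen_Ioo (by norm_num)).contDiffAt hnhds).differentiableAt
      one_ne_zero).hasDerivAt
  have hlhs := ((hdH.pow 2).const_mul 3).sub
    (((hdφ.exp.const_mul 3).mul hddφ).mul (hdH.pow 3))
  have hrhs := (hddφ.pow 2).div_const 2
  have heq := hlhs.unique <| hrhs.congr_of_eventuallyEq <| by
    filter_upwards [hnhds] with r hr
    exact hcon r (Set.Ioo_subset_Ioc_self hr)
  have ht' := Set.Ioo_subset_Ioc_self ht
  refine pointwise_bounds hH hφ (Real.exp_pos _) (hcon t ht') (hfield t ht') ?_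
  simp at heq
  linear_combination heq

theorem EdGB.continuousOn_deriv {a b : ℝ} {H φ : ℝ → ℝ} (hsys : EdGB H φ (Set.Ioc a b))
    (hφ : DifferentiableAt ℝ φ b) : ContinuousOn (deriv φ) (Set.Ioc a b) := by
  have hu : UniqueDiffOn ℝ (Set.Ioc a b) := uniqueDiffOn_Ioc a b
  refine (hsys.2.1.continuousOn_derivWithin hu (by norm_num)).congr fun t ht => ?_
  refine (DifferentiableAt.derivWithin ?_ (hu t ht)).symm
  rcases ht.2.eq_or_lt with rfl | htb
  · exact hφ
  · exact (hsys.2.1.contDiffAt (Ioc_mem_nhds ht.1 htb)).differentiableAt two_ne_zero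

/-- If `H > 0` on a final segment and `φ' < 0` at its right end, then `φ' < 0` throughout. -/
theorem EdGB.deriv_neg {a b c : ℝ} {H φ : ℝ → ℝ} (hsys : EdGB H φ (Set.Ioc a b))
    (hφ : deriv φ b < 0) (hac : a < c) (hH : ∀ t ∈ Set.Icc c b, 0 < H t) :
    ∀ t ∈ Set.Icc c b, deriv φ t < 0 := by
  intro t ht
  by_contra! hneg
  have hcont := hsys.continuousOn_deriv (differentiableAt_of_deriv_ne_zero hφ.ne)
  obtain ⟨r, hr, hr0⟩ := intermediate_value_Icc' ht.2
    (hcont.mono fun r hr => ⟨hac.trans_le (ht.1.trans hr.1), hr.2⟩) ⟨hφ.le, hneg⟩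
  have hcon := hsys.2.2.1 r ⟨hac.trans_le (ht.1.trans hr.1), hr.2⟩
  have hHr := hH r ⟨ht.1.trans hr.1, hr.2⟩
  rw [hr0] at hcon
  nlinarith [pow_pos hHr 2]

/-- Positivity of `H` propagates backward in time. -/
theorem EdGB.pos {a b : ℝ} {H φ : ℝ → ℝ} (hsys : EdGB H φ (Set.Ioc a b))
    (hH : 0 < H b) (hφ : deriv φ b < 0) : ∀ t ∈ Set.Ioc a b, 0 < H t := by
  intro t₁ ht₁
  by_contra! hneg
  have hsub : Set.Icc t₁ b ⊆ Set.Ioc a b := fun r hr => ⟨ht₁.1.trans_le hr.1, hr.2⟩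
  have hHc : ContinuousOn H (Set.Icc t₁ b) := hsys.1.continuousOn.mono hsub
  have hφc : ContinuousOn φ (Set.Icc t₁ b) := hsys.2.1.continuousOn.mono hsub
  have hcpt : IsCompact (Set.Icc t₁ b ∩ H ⁻¹' Set.Iic 0) :=
    isCompact_Icc.of_isClosed_subset (hHc.preimage_isClosed_of_isClosed isClosed_Icc isClosed_Iic)
      Set.inter_subset_left
  obtain ⟨t₀, ⟨ht₀, hHt₀⟩, hmax⟩ := hcpt.exists_isGreatest ⟨t₁, ⟨le_rfl, ht₁.2⟩, hneg⟩
  have hpos : ∀ t ∈ Set.Ioc t₀ b, 0 < H t := fun t ht => by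
    by_contra! h
    exact ht.1.not_ge (hmax ⟨⟨ht₀.1.trans ht.1.le, ht.2⟩, h⟩)
  obtain ⟨C, hC⟩ := isCompact_Icc.bddAbove_image
    (f := fun t => 3 * Real.exp (φ t) * H t ^ 3) (K := Set.Icc t₁ b) (by fun_prop)
  have hanti : AntitoneOn (fun t => H t * Real.exp (-C * t)) (Set.Icc t₀ b) := by
    refine antitoneOn_of_hasDerivWithinAt_nonpos (convex_Icc t₀ b)
      (f' := fun t => (deriv H t - C * H t) * Real.exp (-C * t)) ?_ ?_ ?_
    · exact (hHc.mono (Set.Icc_subset_Icc_left ht₀.1)).mul (by fun_prop)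
    · intro t ht
      rw [interior_Icc] at ht
      have hd := ((hsys.1.contDiffAt (Ioc_mem_nhds (ht₁.1.trans_le (ht₀.1.trans ht.1.le))
        ht.2)).differentiableAt one_ne_zero).hasDerivAt
      have := hd.mul (((hasDerivAt_id t).const_mul (-C)).exp)
      refine (this.congr_deriv ?_).hasDerivWithinAt
      simp
      ring
    · intro t ht
      rw [interior_Icc] at ht
      have hat : a < t := ht₁.1.trans_le (ht₀.1.trans ht.1.le)
      have hHt := hpos t ⟨ht.1, ht.2.le⟩
      have hφt := hsys.deriv_neg hφ hat (fun r hr => hpos r ⟨ht.1.trans_le hr.1, hr.2⟩) t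
        ⟨le_rfl, ht.2.le⟩
      have hlt := (hsys.bounds_of_mem_Ioo ⟨hat, ht.2⟩ hHt hφt).1
      have hCt : 3 * Real.exp (φ t) * H t ^ 3 ≤ C :=
        hC ⟨t, ⟨ht₀.1.trans ht.1.le, ht.2.le⟩, rfl⟩
      refine mul_nonpos_of_nonpos_of_nonneg ?_ (Real.exp_pos _).le
      nlinarith [mul_le_mul_of_nonneg_right hCt hHt.le]
  have hle := hanti ⟨le_rfl, ht₀.2⟩ ⟨ht₀.2, le_rfl⟩ ht₀.2
  have h₀ : H t₀ * Real.exp (-C * t₀) ≤ 0 :=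
    mul_nonpos_of_nonpos_of_nonneg hHt₀ (Real.exp_pos _).le
  exact (mul_pos hH (Real.exp_pos (-C * b))).not_ge (hle.trans h₀)


/-- Sign preservation of `D₄ = H' − (12/5)H⁴e^φ + 3H²` backward in time: if
`(H, φ)` solves the EdGB FLRW system on `(a, 0]` with `H(0) = β > 0`,
`φ'(0) < 0`, `D₄(0) > 0` and `D₃(0) < 0`, then `D₄(t) > 0` for all
`t ∈ (a, 0]`. -/
theorem stmt_16 (a β : ℝ) (ha : a < 0) (H φ : ℝ → ℝ)
    (hsys : EdGB H φ (Set.Ioc a 0))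
    (h0 : H 0 = β) (hβ : 0 < β) (hφ'0 : deriv φ 0 < 0)
    (hD40 : deriv H 0 - (12 / 5) * β ^ 4 * Real.exp (φ 0) + 3 * β ^ 2 > 0)
    (hD30 : deriv H 0 - 3 * β ^ 4 * Real.exp (φ 0) + β ^ 2 < 0) :
    ∀ t ∈ Set.Ioc a 0,
      deriv H t - (12 / 5) * H t ^ 4 * Real.exp (φ t) + 3 * H t ^ 2 > 0 := by
  subst h0
  intro t ht
  rcases ht.2.eq_or_lt with rfl | ht0
  · exact hD40
  · have hpos := hsys.pos hβ hφ'0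
    have hφt := hsys.deriv_neg hφ'0 ht.1 (fun r hr => hpos r ⟨ht.1.trans_le hr.1, hr.2⟩) t
      ⟨le_rfl, ht.2⟩
    exact (hsys.bounds_of_mem_Ioo ⟨ht.1, ht0⟩ (hpos t ht) hφt).2
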